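/- arXiv:2012.12562 — 7 statements merged into one kernel-verified Lean document; each statement's English description precedes it below -/
import Mathlib

section
/- Let K be an entrywise positive m×n real matrix, let a ∈ ℝ^m, b ∈ ℝ^n be entrywise positive vectors, and assume there exists a solution (u*, v*) of the scaling problem. Let Λ = Λ(K) be the Birkhoff contraction ratio of K and let 0 < ω < 2/(1 + Λ). Then for every entrywise positive starting pair (u_0, v_0), the iterates (u_ℓ, v_ℓ) of the overrelaxed Sinkhorn iteration converge to (u*, v*) exponentially fast in the Hilbert projective distance: there exist C ≥ 0 and 0 ≤ ρ < 1 such that d_H(u_ℓ, u*) ≤ C ρ^ℓ and d_H(v_ℓ, v*) ≤ C ρ^ℓ for all ℓ. -/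
open Matrix

/-- Hilbert projective distance between entrywise positive vectors. -/
noncomputable def dH {m : ℕ} (x y : Fin m → ℝ) : ℝ :=
  Real.log (⨆ i, ⨆ j, x i * y j / (x j * y i))

/-- The quantity η(K) = max_{i,j,k,ℓ} K_{ik} K_{jℓ} / (K_{jk} K_{iℓ}). -/
noncomputable def birkhoffEta {m n : ℕ} (K : Matrix (Fin m) (Fin n) ℝ) : ℝ :=
  ⨆ i, ⨆ j, ⨆ k, ⨆ l, K i k * K j l / (K j k * K i l)

/-- The Birkhoff contraction ratio Λ(K). -/
noncomputable def birkhoffLambda {m n : ℕ} (K : Matrix (Fin m) (Fin n) ℝ) : ℝ :=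
  (Real.sqrt (birkhoffEta K) - 1) / (Real.sqrt (birkhoffEta K) + 1)

/-- If `P, Q ∈ [0, 1]` have odds ratio at most `e²`, then `P - Q ≤ (e - 1) / (e + 1)`. -/
theorem sub_le_of_odds_ratio_le {P Q e : ℝ} (hP : 0 ≤ P) (hP1 : P ≤ 1) (hQ : 0 ≤ Q)
    (hQ1 : Q ≤ 1) (he : 1 ≤ e) (h : P * (1 - Q) ≤ e ^ 2 * (Q * (1 - P))) :
    P - Q ≤ (e - 1) / (e + 1) := by
  have h1P : 0 ≤ 1 - P := by linarith
  have h1Q : 0 ≤ 1 - Q := by linarith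
  set X := √P * √(1 - Q) with hX
  set Y := √(1 - P) * √Q with hY
  have hX0 : 0 ≤ X := by positivity
  have hY0 : 0 ≤ Y := by positivity
  have hX2 : X ^ 2 = P * (1 - Q) := by rw [hX, mul_pow, Real.sq_sqrt hP, Real.sq_sqrt h1Q]
  have hY2 : Y ^ 2 = Q * (1 - P) := by
    rw [hY, mul_pow, Real.sq_sqrt hQ, Real.sq_sqrt h1P, mul_comm]
  have hXY : X ≤ e * Y := by
    refine le_of_sq_le_sq ?_ (by positivity)
    rwa [mul_pow e, hX2, hY2]
  have hsum : X + Y ≤ 1 := by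
    nlinarith [sq_nonneg (√P - √(1 - Q)), sq_nonneg (√(1 - P) - √Q), Real.sq_sqrt hP,
      Real.sq_sqrt h1Q, Real.sq_sqrt hQ, Real.sq_sqrt h1P]
  rw [le_div_iff₀ (by linarith)]
  have hdiff : P - Q = (X - Y) * (X + Y) := by linear_combination hY2 - hX2
  rw [hdiff]
  have hsq : (X + Y) * (X + Y) ≤ 1 := by nlinarith
  calc (X - Y) * (X + Y) * (e + 1) = (X + Y) * ((X - Y) * (e + 1)) := by ring
    _ ≤ (X + Y) * ((e - 1) * (X + Y)) :=
      mul_le_mul_of_nonneg_left (by linarith) (by linarith)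
    _ = (e - 1) * ((X + Y) * (X + Y)) := by ring
    _ ≤ e - 1 := mul_le_of_le_one_right (by linarith) hsq

/-- Two probability vectors whose likelihood ratio varies by a factor at most `e²` give averages
of a function that differ by at most `(e - 1) / (e + 1)` times the width of its range. -/
theorem sum_mul_sub_sum_mul_le {ι : Type*} [Fintype ι] {p q g : ι → ℝ} {e lo hi : ℝ}
    (hp : ∀ k, 0 ≤ p k) (hq : ∀ k, 0 ≤ q k) (hp1 : ∑ k, p k = 1) (hq1 : ∑ k, q k = 1)
    (he : 1 ≤ e) (h : ∀ k l, p k * q l ≤ e ^ 2 * (q k * p l))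
    (hlo : ∀ k, lo ≤ g k) (hhi : ∀ k, g k ≤ hi) (hlh : lo ≤ hi) :
    ∑ k, p k * g k - ∑ k, q k * g k ≤ (e - 1) / (e + 1) * (hi - lo) := by
  classical
  set A := Finset.univ.filter fun k => q k ≤ p k
  have hpA := Finset.sum_add_sum_compl A p
  have hqA := Finset.sum_add_sum_compl A q
  rw [hp1] at hpA
  rw [hq1] at hqA
  have hp0 : 0 ≤ ∑ k ∈ A, p k := Finset.sum_nonneg fun k _ => hp k
  have hq0 : 0 ≤ ∑ k ∈ A, q k := Finset.sum_nonneg fun k _ => hq k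
  have hp0' : 0 ≤ ∑ k ∈ Aᶜ, p k := Finset.sum_nonneg fun k _ => hp k
  have hq0' : 0 ≤ ∑ k ∈ Aᶜ, q k := Finset.sum_nonneg fun k _ => hq k
  have hTV : ∑ k ∈ A, p k - ∑ k ∈ A, q k ≤ (e - 1) / (e + 1) := by
    refine sub_le_of_odds_ratio_le hp0 (by linarith) hq0 (by linarith) he ?_
    rw [← eq_sub_of_add_eq' hpA, ← eq_sub_of_add_eq' hqA, Finset.sum_mul_sum, Finset.sum_mul_sum, Finset.mul_sum]
    refine Finset.sum_le_sum fun k _ => ?_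
    rw [Finset.mul_sum]
    exact Finset.sum_le_sum fun l _ => h k l
  calc ∑ k, p k * g k - ∑ k, q k * g k
      = ∑ k, (p k - q k) * (g k - lo) := by
        simp only [sub_mul, mul_sub, Finset.sum_sub_distrib, ← Finset.sum_mul, hp1, hq1]
        ring
    _ ≤ ∑ k, if q k ≤ p k then (p k - q k) * (hi - lo) else 0 := by
        refine Finset.sum_le_sum fun k _ => ?_
        have h1 := hlo k
        have h2 := hhi k
        split_ifs with hk
        · exact mul_le_mul_of_nonneg_left (by linarith) (by linarith)
        · exact mul_nonpos_of_nonpos_of_nonneg (by linarith) (by linarith)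
    _ = (∑ k ∈ A, p k - ∑ k ∈ A, q k) * (hi - lo) := by
        rw [← Finset.sum_filter, ← Finset.sum_mul, Finset.sum_sub_distrib]
    _ ≤ (e - 1) / (e + 1) * (hi - lo) := mul_le_mul_of_nonneg_right hTV (by linarith)

theorem hasDerivAt_log_sum_mul_exp {ι : Type*} [Fintype ι] [Nonempty ι] {p : ι → ℝ}
    (hp : ∀ k, 0 < p k) (g : ι → ℝ) (t : ℝ) :
    HasDerivAt (fun t => Real.log (∑ k, p k * Real.exp (t * g k)))
      (∑ k, p k * Real.exp (t * g k) / (∑ l, p l * Real.exp (t * g l)) * g k) t := by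
  have hpos : 0 < ∑ k, p k * Real.exp (t * g k) :=
    Finset.sum_pos (fun k _ => mul_pos (hp k) (Real.exp_pos _)) Finset.univ_nonempty
  have hsum : HasDerivAt (fun t => ∑ k, p k * Real.exp (t * g k))
      (∑ k, p k * (Real.exp (t * g k) * (1 * g k))) t :=
    HasDerivAt.fun_sum fun k _ => (((hasDerivAt_id t).mul_const (g k)).exp).const_mul (p k)
  convert hsum.log hpos.ne' using 1
  rw [Finset.sum_div]
  exact Finset.sum_congr rfl fun k _ => by ring

/-- The Birkhoff–Hopf contraction inequality for two rows `p`, `q`, in logarithmic coordinates. -/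
theorem log_sum_mul_exp_sub_le {ι : Type*} [Fintype ι] [Nonempty ι] {p q g : ι → ℝ} {e lo hi : ℝ}
    (hp : ∀ k, 0 < p k) (hq : ∀ k, 0 < q k) (he : 1 ≤ e)
    (h : ∀ k l, p k * q l ≤ e ^ 2 * (q k * p l))
    (hlo : ∀ k, lo ≤ g k) (hhi : ∀ k, g k ≤ hi) :
    (Real.log (∑ k, p k * Real.exp (g k)) - Real.log (∑ k, q k * Real.exp (g k))) -
      (Real.log (∑ k, p k) - Real.log (∑ k, q k)) ≤ (e - 1) / (e + 1) * (hi - lo) := by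
  have hlh : lo ≤ hi := (hlo (Classical.arbitrary ι)).trans (hhi _)
  have hderiv := fun t => (hasDerivAt_log_sum_mul_exp hp g t).sub
    (hasDerivAt_log_sum_mul_exp hq g t)
  obtain ⟨t, -, ht⟩ := exists_hasDerivAt_eq_slope _ _ zero_lt_one
    (fun t _ => (hderiv t).continuousAt.continuousWithinAt) (fun t _ => hderiv t)
  simp only [Pi.sub_apply, one_mul, zero_mul, Real.exp_zero, mul_one, sub_zero, div_one] at ht
  rw [← ht]
  have hpos : ∀ {r : ι → ℝ}, (∀ k, 0 < r k) → 0 < ∑ k, r k * Real.exp (t * g k) := fun hr =>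
    Finset.sum_pos (fun k _ => mul_pos (hr k) (Real.exp_pos _)) Finset.univ_nonempty
  have hp' := hpos hp
  have hq' := hpos hq
  refine sum_mul_sub_sum_mul_le (fun k => ?_) (fun k => ?_) ?_ ?_ he (fun k l => ?_) hlo hhi hlh
  · exact div_nonneg (mul_nonneg (hp k).le (Real.exp_pos _).le) hp'.le
  · exact div_nonneg (mul_nonneg (hq k).le (Real.exp_pos _).le) hq'.le
  · rw [← Finset.sum_div, div_self hp'.ne']
  · rw [← Finset.sum_div, div_self hq'.ne']
  · rw [div_mul_div_comm, div_mul_div_comm, mul_comm (∑ l, q l * _), ← mul_div_assoc]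
    refine div_le_div_of_nonneg_right ?_ (mul_pos hp' hq').le
    calc p k * Real.exp (t * g k) * (q l * Real.exp (t * g l))
        = p k * q l * (Real.exp (t * g k) * Real.exp (t * g l)) := by ring
      _ ≤ e ^ 2 * (q k * p l) * (Real.exp (t * g k) * Real.exp (t * g l)) :=
        mul_le_mul_of_nonneg_right (h k l) (by positivity)
      _ = _ := by ring

theorem mulVec_pos_of_pos {m n : ℕ} [NeZero n] {K : Matrix (Fin m) (Fin n) ℝ}
    (hK : ∀ i j, 0 < K i j) {x : Fin n → ℝ} (hx : ∀ k, 0 < x k) (i : Fin m) :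
    0 < K.mulVec x i :=
  Finset.sum_pos (fun k _ => mul_pos (hK i k) (hx k)) Finset.univ_nonempty

/-- The Birkhoff–Hopf theorem: `K` contracts the oscillation of `log x - log y`. -/
theorem log_mulVec_osc_le {m n : ℕ} [NeZero n] {K : Matrix (Fin m) (Fin n) ℝ}
    (hK : ∀ i j, 0 < K i j) {e M : ℝ} (he : 1 ≤ e)
    (h : ∀ i j k l, K i k * K j l ≤ e ^ 2 * (K j k * K i l)) {x y : Fin n → ℝ}
    (hx : ∀ k, 0 < x k) (hy : ∀ k, 0 < y k)
    (hM : ∀ k l, (Real.log (x k) - Real.log (y k)) - (Real.log (x l) - Real.log (y l)) ≤ M)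
    (i j : Fin m) :
    (Real.log (K.mulVec x i) - Real.log (K.mulVec y i)) -
      (Real.log (K.mulVec x j) - Real.log (K.mulVec y j)) ≤ (e - 1) / (e + 1) * M := by
  set g : Fin n → ℝ := fun k => Real.log (x k) - Real.log (y k) with hg
  have hxg : ∀ k, x k = y k * Real.exp (g k) := fun k => by
    rw [hg, Real.exp_sub, Real.exp_log (hx k), Real.exp_log (hy k), mul_div_cancel₀ _ (hy k).ne']
  have hKx : ∀ i, K.mulVec x i = ∑ k, K i k * y k * Real.exp (g k) := fun i => by
    simp only [mul_assoc, ← hxg]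
    rfl
  have hKy : ∀ i, K.mulVec y i = ∑ k, K i k * y k := fun i => rfl
  obtain ⟨kmin, hmin⟩ := Finite.exists_min g
  obtain ⟨kmax, hmax⟩ := Finite.exists_max g
  have key := log_sum_mul_exp_sub_le (p := fun k => K i k * y k) (q := fun k => K j k * y k)
    (fun k => mul_pos (hK i k) (hy k)) (fun k => mul_pos (hK j k) (hy k)) he
    (fun k l => by
      have := mul_le_mul_of_nonneg_right (h i j k l) (mul_pos (hy k) (hy l)).le
      linarith) hmin hmax
  rw [hKx, hKx, hKy, hKy]
  have hle : (e - 1) / (e + 1) * (g kmax - g kmin) ≤ (e - 1) / (e + 1) * M :=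
    mul_le_mul_of_nonneg_left (hM _ _) (div_nonneg (by linarith) (by linarith))
  linarith

/-- One overrelaxed half step: the oscillation of the log error is bounded by the combination of
the previous ones with weights `|1 - ω|` and `ω (e - 1) / (e + 1)`. -/
theorem overrelaxed_step_osc_le {m n : ℕ} [NeZero n] {K : Matrix (Fin m) (Fin n) ℝ}
    (hK : ∀ i j, 0 < K i j) {e : ℝ} (he : 1 ≤ e)
    (h : ∀ i j k l, K i k * K j l ≤ e ^ 2 * (K j k * K i l))
    {a x x' xstar : Fin m → ℝ} {y ystar : Fin n → ℝ}
    (ha : ∀ i, 0 < a i) (hx : ∀ i, 0 < x i) (hxstar : ∀ i, 0 < xstar i)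
    (hy : ∀ k, 0 < y k) (hystar : ∀ k, 0 < ystar k)
    (hsol : ∀ i, xstar i * K.mulVec ystar i = a i) {ω : ℝ} (hω : 0 < ω)
    (hx' : ∀ i, x' i = x i ^ (1 - ω) * (a i / K.mulVec y i) ^ ω) {M N : ℝ}
    (hM : ∀ i j, (Real.log (x i) - Real.log (xstar i)) -
      (Real.log (x j) - Real.log (xstar j)) ≤ M)
    (hN : ∀ k l, (Real.log (y k) - Real.log (ystar k)) -
      (Real.log (y l) - Real.log (ystar l)) ≤ N) (i j : Fin m) :
    (Real.log (x' i) - Real.log (xstar i)) - (Real.log (x' j) - Real.log (xstar j)) ≤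
      |1 - ω| * M + ω * ((e - 1) / (e + 1)) * N := by
  have hlog : ∀ i, Real.log (x' i) - Real.log (xstar i) =
      (1 - ω) * (Real.log (x i) - Real.log (xstar i)) -
        ω * (Real.log (K.mulVec y i) - Real.log (K.mulVec ystar i)) := fun i => by
    have h1 := mulVec_pos_of_pos hK hy i
    have h2 := mulVec_pos_of_pos hK hystar i
    have h3 := div_pos (ha i) h1
    rw [hx' i, Real.log_mul (Real.rpow_pos_of_pos (hx i) _).ne' (Real.rpow_pos_of_pos h3 _).ne',
      Real.log_rpow (hx i), Real.log_rpow h3, Real.log_div (ha i).ne' h1.ne', ← hsol i,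
      Real.log_mul (hxstar i).ne' h2.ne']
    ring
  have hc := mul_le_mul_of_nonneg_left (log_mulVec_osc_le hK he h hy hystar hN j i) hω.le
  set d := (Real.log (x i) - Real.log (xstar i)) - (Real.log (x j) - Real.log (xstar j)) with hd
  have hd' : |d| ≤ M := abs_le.2 ⟨by linarith [hM j i], hM i j⟩
  have hb : (1 - ω) * d ≤ |1 - ω| * M :=
    (le_abs_self _).trans ((abs_mul _ _).trans_le
      (mul_le_mul_of_nonneg_left hd' (abs_nonneg _)))
  rw [hlog, hlog]
  rw [hd] at hb
  linarith

theorem dH_le_of_log_osc_le {m : ℕ} {x y : Fin m → ℝ} (hx : ∀ i, 0 < x i) (hy : ∀ i, 0 < y i)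
    {M : ℝ} (hM0 : 0 ≤ M)
    (hM : ∀ i j, (Real.log (x i) - Real.log (y i)) - (Real.log (x j) - Real.log (y j)) ≤ M) :
    dH x y ≤ M := by
  have hle : ⨆ i, ⨆ j, x i * y j / (x j * y i) ≤ Real.exp M := by
    refine Real.iSup_le (fun i => Real.iSup_le (fun j => ?_) (Real.exp_pos M).le)
      (Real.exp_pos M).le
    have h1 := mul_pos (hx i) (hy j)
    have h2 := mul_pos (hx j) (hy i)
    rw [← Real.log_le_iff_le_exp (div_pos h1 h2), Real.log_div h1.ne' h2.ne',
      Real.log_mul (hx i).ne' (hy j).ne', Real.log_mul (hx j).ne' (hy i).ne']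
    linarith [hM i j]
  have hnonneg : 0 ≤ ⨆ i, ⨆ j, x i * y j / (x j * y i) :=
    Real.iSup_nonneg fun i => Real.iSup_nonneg fun j =>
      div_nonneg (mul_pos (hx i) (hy j)).le (mul_pos (hx j) (hy i)).le
  unfold dH
  rcases hnonneg.eq_or_lt with h0 | hpos
  · rw [← h0, Real.log_zero]
    exact hM0
  · exact (Real.log_le_iff_le_exp hpos).2 hle

theorem exists_log_osc_le {m : ℕ} (x y : Fin m → ℝ) :
    ∃ M, 0 ≤ M ∧
      ∀ i j, (Real.log (x i) - Real.log (y i)) - (Real.log (x j) - Real.log (y j)) ≤ M := by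
  obtain ⟨M, hM⟩ := Finite.bddAbove_range fun p : Fin m × Fin m =>
    (Real.log (x p.1) - Real.log (y p.1)) - (Real.log (x p.2) - Real.log (y p.2))
  exact ⟨max M 0, le_max_right _ _, fun i j => (hM ⟨(i, j), rfl⟩).trans (le_max_left _ _)⟩

theorem le_birkhoffEta {m n : ℕ} (K : Matrix (Fin m) (Fin n) ℝ) (i j : Fin m) (k l : Fin n) :
    K i k * K j l / (K j k * K i l) ≤ birkhoffEta K :=
  (le_ciSup (f := fun l => K i k * K j l / (K j k * K i l)) (Finite.bddAbove_range _) l).trans <|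
    (le_ciSup (f := fun k => ⨆ l, K i k * K j l / (K j k * K i l))
      (Finite.bddAbove_range _) k).trans <|
    (le_ciSup (f := fun j => ⨆ k, ⨆ l, K i k * K j l / (K j k * K i l))
      (Finite.bddAbove_range _) j).trans <|
    le_ciSup (f := fun i => ⨆ j, ⨆ k, ⨆ l, K i k * K j l / (K j k * K i l))
      (Finite.bddAbove_range _) i

theorem birkhoffLambda_of_isEmpty {m n : ℕ} (h : m = 0 ∨ n = 0) (K : Matrix (Fin m) (Fin n) ℝ) :
    birkhoffLambda K = -1 := by
  have : birkhoffEta K = 0 := by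
    unfold birkhoffEta
    rcases h with rfl | rfl <;> simp
  simp [birkhoffLambda, this]

theorem global_convergence_of_overrelaxed_Sinkhorn
    {m n : ℕ} (K : Matrix (Fin m) (Fin n) ℝ) (hK : ∀ i j, 0 < K i j)
    (a : Fin m → ℝ) (b : Fin n → ℝ) (ha : ∀ i, 0 < a i) (hb : ∀ j, 0 < b j)
    (ustar : Fin m → ℝ) (vstar : Fin n → ℝ)
    (hustar : ∀ i, 0 < ustar i) (hvstar : ∀ j, 0 < vstar j)
    (hsol1 : ∀ i, ustar i * K.mulVec vstar i = a i)
    (hsol2 : ∀ j, vstar j * Kᵀ.mulVec ustar j = b j)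
    (ω : ℝ) (hω0 : 0 < ω) (hω2 : ω < 2 / (1 + birkhoffLambda K))
    (u : ℕ → Fin m → ℝ) (v : ℕ → Fin n → ℝ)
    (hu0 : ∀ i, 0 < u 0 i) (hv0 : ∀ j, 0 < v 0 j)
    (hiter1 : ∀ ℓ i, u (ℓ + 1) i = u ℓ i ^ (1 - ω) * (a i / K.mulVec (v ℓ) i) ^ ω)
    (hiter2 : ∀ ℓ j, v (ℓ + 1) j = v ℓ j ^ (1 - ω) * (b j / Kᵀ.mulVec (u (ℓ + 1)) j) ^ ω) :
    ∃ C : ℝ, 0 ≤ C ∧ ∃ ρ : ℝ, 0 ≤ ρ ∧ ρ < 1 ∧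
      ∀ ℓ : ℕ, dH (u ℓ) ustar ≤ C * ρ ^ ℓ ∧ dH (v ℓ) vstar ≤ C * ρ ^ ℓ := by
  have hmn : ¬(m = 0 ∨ n = 0) := fun h => by
    rw [birkhoffLambda_of_isEmpty h, add_neg_cancel, div_zero] at hω2
    exact hω0.not_gt hω2
  rw [not_or] at hmn
  have : NeZero m := ⟨hmn.1⟩
  have : NeZero n := ⟨hmn.2⟩
  have hη1 : 1 ≤ birkhoffEta K := by
    have h := le_birkhoffEta K 0 0 0 0
    rwa [div_self (mul_pos (hK 0 0) (hK 0 0)).ne'] at h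
  unfold birkhoffLambda at hω2
  set e := √(birkhoffEta K) with he_def
  have he : 1 ≤ e := Real.one_le_sqrt.2 hη1
  have hcross : ∀ i j k l, K i k * K j l ≤ e ^ 2 * (K j k * K i l) := fun i j k l => by
    rw [he_def, Real.sq_sqrt (by linarith)]
    exact (div_le_iff₀ (mul_pos (hK j k) (hK i l))).1 (le_birkhoffEta K i j k l)
  have hKt : ∀ j i, 0 < Kᵀ j i := fun j i => hK i j
  have hcross' : ∀ i j k l, Kᵀ i k * Kᵀ j l ≤ e ^ 2 * (Kᵀ j k * Kᵀ i l) := fun i j k l => by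
    simpa only [transpose_apply, mul_comm (K k j)] using hcross k l i j
  set Λ := (e - 1) / (e + 1) with hΛ
  have hΛ0 : 0 ≤ Λ := div_nonneg (by linarith) (by linarith)
  have hΛ1 : Λ < 1 := (div_lt_one (by linarith)).2 (by linarith)
  set ρ := |1 - ω| + ω * Λ with hρ
  have hρ0 : 0 ≤ ρ := by positivity
  have hρ1 : ρ < 1 := by
    rw [lt_div_iff₀ (by linarith)] at hω2
    rcases abs_cases (1 - ω) with ⟨h, -⟩ | ⟨h, -⟩ <;> rw [hρ, h] <;> nlinarith
  have hpos : ∀ ℓ, (∀ i, 0 < u ℓ i) ∧ ∀ j, 0 < v ℓ j := fun ℓ => by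
    induction ℓ with
    | zero => exact ⟨hu0, hv0⟩
    | succ ℓ ih =>
      have hu : ∀ i, 0 < u (ℓ + 1) i := fun i => by
        rw [hiter1]
        exact mul_pos (Real.rpow_pos_of_pos (ih.1 i) _)
          (Real.rpow_pos_of_pos (div_pos (ha i) (mulVec_pos_of_pos hK ih.2 i)) _)
      refine ⟨hu, fun j => ?_⟩
      rw [hiter2]
      exact mul_pos (Real.rpow_pos_of_pos (ih.2 j) _)
        (Real.rpow_pos_of_pos (div_pos (hb j) (mulVec_pos_of_pos hKt hu j)) _)
  obtain ⟨Mu, hMu0, hMu⟩ := exists_log_osc_le (u 0) ustar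
  obtain ⟨Mv, -, hMv⟩ := exists_log_osc_le (v 0) vstar
  set C := max Mu Mv with hC
  have hC0 : 0 ≤ C := hMu0.trans (le_max_left _ _)
  have hosc : ∀ ℓ,
      (∀ i j, (Real.log (u ℓ i) - Real.log (ustar i)) -
        (Real.log (u ℓ j) - Real.log (ustar j)) ≤ C * ρ ^ ℓ) ∧
      ∀ i j, (Real.log (v ℓ i) - Real.log (vstar i)) -
        (Real.log (v ℓ j) - Real.log (vstar j)) ≤ C * ρ ^ ℓ := fun ℓ => by
    induction ℓ with
    | zero =>
      rw [pow_zero, mul_one]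
      exact ⟨fun i j => (hMu i j).trans (le_max_left _ _),
        fun i j => (hMv i j).trans (le_max_right _ _)⟩
    | succ ℓ ih =>
      have hstep : |1 - ω| * (C * ρ ^ ℓ) + ω * Λ * (C * ρ ^ ℓ) = C * ρ ^ (ℓ + 1) := by
        rw [hρ]
        ring
      have hu := overrelaxed_step_osc_le hK he hcross ha (hpos ℓ).1 hustar (hpos ℓ).2 hvstar
        hsol1 hω0 (hiter1 ℓ) ih.1 ih.2
      rw [← hΛ, hstep] at hu
      refine ⟨hu, fun i j => ?_⟩
      have hdecr : C * ρ ^ (ℓ + 1) ≤ C * ρ ^ ℓ :=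
        mul_le_mul_of_nonneg_left (pow_le_pow_of_le_one hρ0 hρ1.le ℓ.le_succ) hC0
      have hv := overrelaxed_step_osc_le hKt he hcross' hb (hpos ℓ).2 hvstar (hpos (ℓ + 1)).1
        hustar hsol2 hω0 (hiter2 ℓ) ih.2 (fun k l => (hu k l).trans hdecr) i j
      rwa [← hΛ, hstep] at hv
  exact ⟨C, hC0, ρ, hρ0, hρ1, fun ℓ =>
    ⟨dH_le_of_log_osc_le (hpos ℓ).1 hustar (by positivity) (hosc ℓ).1,
      dH_le_of_log_osc_le (hpos ℓ).2 hvstar (by positivity) (hosc ℓ).2⟩⟩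
end

section
/- Let K be an entrywise positive m×n real matrix with m ≥ n ≥ 2 and rank(K) = n, let a ∈ ℝ^m, b ∈ ℝ^n be entrywise positive vectors with Σ_i a_i = Σ_j b_j = 1, and let (u*, v*) be a solution of the scaling problem. Then ϑ² ≥ δ₁, where δ₁ = (a_min / b_max) · (1 − b_max) / ((‖K‖_∞/σ_min(K))² − a_min). -/
open Matrix

/-- The matrix H = diag(u*/√a) K diag(v*∘v*/b) Kᵀ diag(u*/√a). -/
noncomputable def Hmat {m n : ℕ} (K : Matrix (Fin m) (Fin n) ℝ)
    (a : Fin m → ℝ) (b : Fin n → ℝ) (u : Fin m → ℝ) (v : Fin n → ℝ) :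
    Matrix (Fin m) (Fin m) ℝ :=
  Matrix.diagonal (fun i => u i / Real.sqrt (a i)) * K *
    Matrix.diagonal (fun j => v j * v j / b j) * Kᵀ *
    Matrix.diagonal (fun i => u i / Real.sqrt (a i))

/-- ϑ² = sup of the Rayleigh quotient of H over the orthogonal complement of √a. -/
noncomputable def thetaSq {m n : ℕ} (K : Matrix (Fin m) (Fin n) ℝ)
    (a : Fin m → ℝ) (b : Fin n → ℝ) (u : Fin m → ℝ) (v : Fin n → ℝ) : ℝ :=
  sSup {r : ℝ | ∃ w : Fin m → ℝ, w ≠ 0 ∧ (w ⬝ᵥ fun i => Real.sqrt (a i)) = 0 ∧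
    r = w ⬝ᵥ (Hmat K a b u v).mulVec w / (w ⬝ᵥ w)}

/-- Maximum absolute row-sum norm ‖K‖_∞. -/
noncomputable def normInfRow {m n : ℕ} (K : Matrix (Fin m) (Fin n) ℝ) : ℝ :=
  ⨆ i, ∑ j, |K i j|

/-- The smallest positive singular value of K. -/
noncomputable def sigmaMin {m n : ℕ} (K : Matrix (Fin m) (Fin n) ℝ) : ℝ :=
  sInf {s : ℝ | 0 < s ∧ ∃ x : Fin n → ℝ, x ≠ 0 ∧ (Kᵀ * K).mulVec x = (s ^ 2) • x}

lemma mulVec_ne_zero_of_rank_eq {m n : ℕ} {K : Matrix (Fin m) (Fin n) ℝ} (hrank : K.rank = n)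
    {x : Fin n → ℝ} (hx : x ≠ 0) : K *ᵥ x ≠ 0 := by
  have hli : LinearIndependent ℝ K.col := by
    rw [linearIndependent_iff_card_eq_finrank_span, Set.finrank,
      ← Matrix.rank_eq_finrank_span_cols, hrank, Fintype.card_fin]
  intro h
  exact hx (Matrix.mulVec_injective_iff.2 hli (h.trans (Matrix.mulVec_zero K).symm))

lemma sigmaMin_nonneg {m n : ℕ} (K : Matrix (Fin m) (Fin n) ℝ) : 0 ≤ sigmaMin K :=
  Real.sInf_nonneg fun _ hs => hs.1.le

/-- The square of the smallest singular value bounds the Rayleigh quotient of `Kᵀ K` below. -/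
lemma sigmaMin_sq_mul_le {m n : ℕ} {K : Matrix (Fin m) (Fin n) ℝ} (hrank : K.rank = n)
    (x : Fin n → ℝ) : sigmaMin K ^ 2 * (x ⬝ᵥ x) ≤ K *ᵥ x ⬝ᵥ K *ᵥ x := by
  have hgram (y : Fin n → ℝ) : (Kᵀ * K) *ᵥ y ⬝ᵥ y = K *ᵥ y ⬝ᵥ K *ᵥ y := by
    rw [← Matrix.mulVec_mulVec, Matrix.mulVec_transpose, Matrix.dotProduct_mulVec]
  have hself (k : ℕ) (y : Fin k → ℝ) : 0 ≤ y ⬝ᵥ y :=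
    Finset.sum_nonneg fun i _ => mul_self_nonneg (y i)
  rcases eq_or_ne x 0 with rfl | hx
  · simp
  let T := Matrix.toEuclideanLin (Kᵀ * K)
  have hinner (y : EuclideanSpace ℝ (Fin n)) :
      inner ℝ (T y) y = K *ᵥ y.ofLp ⬝ᵥ K *ᵥ y.ofLp := by
    rw [← hgram, EuclideanSpace.inner_eq_star_dotProduct, dotProduct_comm]
    simp [T]
  have hnorm (y : EuclideanSpace ℝ (Fin n)) : ‖y‖ ^ 2 = y.ofLp ⬝ᵥ y.ofLp := by
    rw [EuclideanSpace.real_norm_sq_eq]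
    simp [dotProduct, sq]
  have hT : T.IsSymmetric := by
    rw [Matrix.isSymmetric_toEuclideanLin_iff]
    simpa using Matrix.isHermitian_conjTranspose_mul_self K
  have hxE : WithLp.toLp 2 x ≠ 0 := by simpa using hx
  have : Nontrivial (EuclideanSpace ℝ (Fin n)) := ⟨_, _, hxE⟩
  have hquot (y : EuclideanSpace ℝ (Fin n)) :
      RCLike.re (inner ℝ (T y) y) / ‖y‖ ^ 2 =
        (K *ᵥ y.ofLp ⬝ᵥ K *ᵥ y.ofLp) / (y.ofLp ⬝ᵥ y.ofLp) := by
    rw [hinner, hnorm]; rfl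
  obtain ⟨y, hy⟩ := hT.hasEigenvalue_iInf_of_finiteDimensional.exists_hasEigenvector
  have hle := ciInf_le (f := fun z : {z : EuclideanSpace ℝ (Fin n) // z ≠ 0} =>
      RCLike.re (inner ℝ (T z) (z : EuclideanSpace ℝ (Fin n))) /
        ‖(z : EuclideanSpace ℝ (Fin n))‖ ^ 2)
    ⟨0, by
      rintro _ ⟨z, rfl⟩
      simp only [hquot]
      exact div_nonneg (hself _ _) (hself _ _)⟩ ⟨_, hxE⟩
  set μ := ⨅ z : {z : EuclideanSpace ℝ (Fin n) // z ≠ 0},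
      RCLike.re (inner ℝ (T z) (z : EuclideanSpace ℝ (Fin n))) /
        ‖(z : EuclideanSpace ℝ (Fin n))‖ ^ 2
  have hy0 : y.ofLp ≠ 0 := by simpa using hy.2
  have heig : (Kᵀ * K) *ᵥ y.ofLp = μ • y.ofLp := by
    simpa [T] using congrArg WithLp.ofLp hy.apply_eq_smul
  have hypos : 0 < y.ofLp ⬝ᵥ y.ofLp :=
    lt_of_le_of_ne (hself _ _) fun h => hy0 (dotProduct_self_eq_zero.1 h.symm)
  have hKypos : 0 < K *ᵥ y.ofLp ⬝ᵥ K *ᵥ y.ofLp :=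
    lt_of_le_of_ne (hself _ _) fun h =>
      mulVec_ne_zero_of_rank_eq hrank hy0 (dotProduct_self_eq_zero.1 h.symm)
  have hμ : 0 < μ := by
    rw [← hgram, heig, smul_dotProduct, smul_eq_mul] at hKypos
    exact pos_of_mul_pos_left hKypos hypos.le
  have hσ : sigmaMin K ≤ √μ :=
    csInf_le ⟨0, fun _ hs => hs.1.le⟩
      ⟨Real.sqrt_pos.2 hμ, y.ofLp, hy0, by rw [Real.sq_sqrt hμ.le, heig]⟩
  have hσsq : sigmaMin K ^ 2 ≤ μ := by
    rw [← Real.sq_sqrt hμ.le]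
    exact pow_le_pow_left₀ (sigmaMin_nonneg K) hσ 2
  have hxpos : 0 < x ⬝ᵥ x :=
    lt_of_le_of_ne (hself _ _) fun h => hx (dotProduct_self_eq_zero.1 h.symm)
  simp only [hquot] at hle
  exact (le_div_iff₀ hxpos).1 (hσsq.trans hle)

lemma dotProduct_Hmat_mulVec {m n : ℕ} (K : Matrix (Fin m) (Fin n) ℝ)
    (a : Fin m → ℝ) (b : Fin n → ℝ) (u : Fin m → ℝ) (v : Fin n → ℝ) (w : Fin m → ℝ) :
    w ⬝ᵥ Hmat K a b u v *ᵥ w =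
      ∑ j, v j ^ 2 / b j * (∑ i, K i j * (u i / √(a i) * w i)) ^ 2 := by
  let D := Matrix.diagonal fun i => u i / √(a i)
  have hD : w ᵥ* D = D *ᵥ w := by
    ext i
    simp [D, Matrix.vecMul_diagonal, Matrix.mulVec_diagonal, mul_comm]
  have hKD : (D *ᵥ w) ᵥ* K = Kᵀ *ᵥ D *ᵥ w := (Matrix.mulVec_transpose _ _).symm
  calc w ⬝ᵥ Hmat K a b u v *ᵥ w
      = Kᵀ *ᵥ D *ᵥ w ⬝ᵥ Matrix.diagonal (fun j => v j * v j / b j) *ᵥ Kᵀ *ᵥ D *ᵥ w := by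
        simp only [Hmat, ← Matrix.mulVec_mulVec]
        rw [Matrix.dotProduct_mulVec, hD, Matrix.dotProduct_mulVec, hKD]
    _ = _ := by
        simp only [dotProduct, Matrix.mulVec_diagonal, D]
        refine Finset.sum_congr rfl fun j _ => ?_
        simp only [Matrix.mulVec, dotProduct, Matrix.transpose_apply, Matrix.diagonal_apply,
          ite_mul, zero_mul, Finset.sum_ite_eq, Finset.mem_univ, if_true]
        ring

lemma dotProduct_Hmat_mulVec_nonneg {m n : ℕ} (K : Matrix (Fin m) (Fin n) ℝ)
    (a : Fin m → ℝ) {b : Fin n → ℝ} (hb : ∀ j, 0 < b j) (u : Fin m → ℝ) (v : Fin n → ℝ)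
    (w : Fin m → ℝ) : 0 ≤ w ⬝ᵥ Hmat K a b u v *ᵥ w := by
  rw [dotProduct_Hmat_mulVec]
  exact Finset.sum_nonneg fun j _ =>
    mul_nonneg (div_nonneg (sq_nonneg _) (hb j).le) (sq_nonneg _)

lemma thetaSq_nonneg {m n : ℕ} (K : Matrix (Fin m) (Fin n) ℝ)
    (a : Fin m → ℝ) {b : Fin n → ℝ} (hb : ∀ j, 0 < b j) (u : Fin m → ℝ) (v : Fin n → ℝ) :
    0 ≤ thetaSq K a b u v := by
  refine Real.sSup_nonneg ?_
  rintro _ ⟨w, -, -, rfl⟩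
  exact div_nonneg (dotProduct_Hmat_mulVec_nonneg K a hb u v w)
    (Finset.sum_nonneg fun i _ => mul_self_nonneg (w i))

lemma dotProduct_mulVec_le_sum_abs {m : ℕ} (M : Matrix (Fin m) (Fin m) ℝ) (w : Fin m → ℝ) :
    w ⬝ᵥ M *ᵥ w ≤ (∑ i, ∑ j, |M i j|) * (w ⬝ᵥ w) := by
  have hsq (i : Fin m) : w i * w i ≤ w ⬝ᵥ w :=
    Finset.single_le_sum (f := fun k => w k * w k) (fun k _ => mul_self_nonneg (w k))
      (Finset.mem_univ i)
  simp only [Finset.sum_mul]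
  rw [dotProduct]
  refine Finset.sum_le_sum fun i _ => ?_
  rw [Matrix.mulVec, dotProduct, Finset.mul_sum]
  refine Finset.sum_le_sum fun j _ => ?_
  have hw : |w i * w j| ≤ w ⬝ᵥ w := by
    rw [abs_le]
    constructor <;> nlinarith [hsq i, hsq j, sq_nonneg (w i + w j), sq_nonneg (w i - w j)]
  calc w i * (M i j * w j) = M i j * (w i * w j) := by ring
    _ ≤ |M i j| * |w i * w j| := by rw [← abs_mul]; exact le_abs_self _
    _ ≤ _ := mul_le_mul_of_nonneg_left hw (abs_nonneg _)

lemma dotProduct_Hmat_mulVec_le {m n : ℕ} (K : Matrix (Fin m) (Fin n) ℝ)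
    (a : Fin m → ℝ) (b : Fin n → ℝ) (u : Fin m → ℝ) (v : Fin n → ℝ) {w : Fin m → ℝ}
    (hw : w ≠ 0) (hwa : (w ⬝ᵥ fun i => √(a i)) = 0) :
    w ⬝ᵥ Hmat K a b u v *ᵥ w / (w ⬝ᵥ w) ≤ thetaSq K a b u v := by
  refine le_csSup ⟨∑ i, ∑ j, |Hmat K a b u v i j|, ?_⟩ ⟨w, hw, hwa, rfl⟩
  rintro _ ⟨z, hz, -, rfl⟩
  have hzpos : 0 < z ⬝ᵥ z :=
    lt_of_le_of_ne (Finset.sum_nonneg fun i _ => mul_self_nonneg (z i))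
      fun h => hz (dotProduct_self_eq_zero.1 h.symm)
  exact (div_le_iff₀ hzpos).2 (dotProduct_mulVec_le_sum_abs _ z)

/-- Mass transport from the first to the second marginal of the coupling `u i * K i j * v j`. -/
lemma sum_mul_mulVec_mul {m n : ℕ} {K : Matrix (Fin m) (Fin n) ℝ} {b : Fin n → ℝ}
    {u : Fin m → ℝ} {v : Fin n → ℝ} (hsol2 : ∀ j, v j * (Kᵀ *ᵥ u) j = b j) (f : Fin n → ℝ) :
    ∑ i, u i * (K *ᵥ fun j => v j * f j) i = ∑ j, b j * f j := by
  simp only [← hsol2, Matrix.mulVec, dotProduct, Finset.mul_sum, Finset.sum_mul]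
  rw [Finset.sum_comm]
  refine Finset.sum_congr rfl fun j _ => Finset.sum_congr rfl fun i _ => ?_
  rw [Matrix.transpose_apply]
  ring

/-- The sum of `a i * g i ^ 2`, where `g` is the conditional expectation of a `b`-centred `f`
under the coupling `u i * K i j * v j`, is at most `ϑ²` times the `b`-variance of `f`. -/
lemma sum_mul_sq_le_thetaSq_mul {m n : ℕ} {K : Matrix (Fin m) (Fin n) ℝ}
    {a : Fin m → ℝ} {b : Fin n → ℝ} (ha : ∀ i, 0 < a i) (hb : ∀ j, 0 < b j)
    {u : Fin m → ℝ} {v : Fin n → ℝ}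
    (hsol2 : ∀ j, v j * (Kᵀ *ᵥ u) j = b j)
    {f : Fin n → ℝ} {g : Fin m → ℝ} (hf : ∑ j, b j * f j = 0)
    (hg : ∀ i, a i * g i = u i * (K *ᵥ fun j => v j * f j) i) :
    ∑ i, a i * g i ^ 2 ≤ thetaSq K a b u v * ∑ j, b j * f j ^ 2 := by
  have hF : 0 ≤ ∑ j, b j * f j ^ 2 :=
    Finset.sum_nonneg fun j _ => mul_nonneg (hb j).le (sq_nonneg _)
  have hS0 : 0 ≤ ∑ i, a i * g i ^ 2 :=
    Finset.sum_nonneg fun i _ => mul_nonneg (ha i).le (sq_nonneg _)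
  rcases hS0.eq_or_lt with hS | hS
  · rw [← hS]
    exact mul_nonneg (thetaSq_nonneg K a hb u v) hF
  let w : Fin m → ℝ := fun i => √(a i) * g i
  have hww : w ⬝ᵥ w = ∑ i, a i * g i ^ 2 := by
    refine Finset.sum_congr rfl fun i _ => ?_
    calc √(a i) * g i * (√(a i) * g i) = (√(a i) * √(a i)) * g i ^ 2 := by ring
      _ = _ := by rw [Real.mul_self_sqrt (ha i).le]
  have hw : w ≠ 0 := by
    intro h
    rw [← hww, h] at hS
    simp at hS
  have hwa : (w ⬝ᵥ fun i => √(a i)) = 0 := by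
    calc (w ⬝ᵥ fun i => √(a i)) = ∑ i, a i * g i := by
          refine Finset.sum_congr rfl fun i _ => ?_
          calc √(a i) * g i * √(a i) = (√(a i) * √(a i)) * g i := by ring
            _ = _ := by rw [Real.mul_self_sqrt (ha i).le]
      _ = 0 := by simp only [hg, sum_mul_mulVec_mul hsol2, hf]
  have hH : w ⬝ᵥ Hmat K a b u v *ᵥ w = ∑ j, (v j * ∑ i, K i j * (u i * g i)) ^ 2 / b j := by
    rw [dotProduct_Hmat_mulVec]
    refine Finset.sum_congr rfl fun j _ => ?_
    have hsum : ∑ i, K i j * (u i / √(a i) * w i) = ∑ i, K i j * (u i * g i) := by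
      refine Finset.sum_congr rfl fun i _ => ?_
      have := (Real.sqrt_pos.2 (ha i)).ne'
      simp only [w]
      field_simp
    rw [hsum]
    ring
  have hSh : ∑ i, a i * g i ^ 2 = ∑ j, f j * (v j * ∑ i, K i j * (u i * g i)) := by
    calc ∑ i, a i * g i ^ 2 = ∑ i, ∑ j, u i * (K i j * (v j * f j)) * g i := by
          refine Finset.sum_congr rfl fun i _ => ?_
          rw [sq, ← mul_assoc, hg, Matrix.mulVec, dotProduct, Finset.mul_sum, Finset.sum_mul]
      _ = _ := by
          rw [Finset.sum_comm]
          refine Finset.sum_congr rfl fun j _ => ?_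
          simp only [Finset.mul_sum]
          refine Finset.sum_congr rfl fun i _ => ?_
          ring
  have hCS : (∑ i, a i * g i ^ 2) ^ 2 ≤
      (∑ j, b j * f j ^ 2) * (w ⬝ᵥ Hmat K a b u v *ᵥ w) := by
    rw [hSh, hH]
    refine Finset.sum_sq_le_sum_mul_sum_of_sq_le_mul _
      (fun j _ => mul_nonneg (hb j).le (sq_nonneg _))
      (fun j _ => div_nonneg (sq_nonneg _) (hb j).le) fun j _ => le_of_eq ?_
    have := (hb j).ne'
    field_simp
  have hle := dotProduct_Hmat_mulVec_le K a b u v hw hwa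
  rw [hww, div_le_iff₀ hS] at hle
  have := hCS.trans (mul_le_mul_of_nonneg_left hle hF)
  nlinarith

lemma mulVec_le_normInfRow_mul {m n : ℕ} (K : Matrix (Fin m) (Fin n) ℝ) {v : Fin n → ℝ} {c : ℝ}
    (hv : ∀ j, |v j| ≤ c) (hc : 0 ≤ c) (i : Fin m) : (K *ᵥ v) i ≤ normInfRow K * c := by
  have hrow : ∑ j, |K i j| ≤ normInfRow K :=
    le_ciSup (f := fun i => ∑ j, |K i j|) (Set.finite_range _).bddAbove i
  calc (K *ᵥ v) i = ∑ j, K i j * v j := rfl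
    _ ≤ ∑ j, |K i j| * c := Finset.sum_le_sum fun j _ =>
        (le_abs_self _).trans (by
          rw [abs_mul]; exact mul_le_mul_of_nonneg_left (hv j) (abs_nonneg _))
    _ = (∑ j, |K i j|) * c := (Finset.sum_mul ..).symm
    _ ≤ _ := mul_le_mul_of_nonneg_right hrow hc

/-- Lower bound for the `a`-weighted square norm of the quotients `K (v f) / K v` by the value of
`f` at an index where `v` is maximal. -/
lemma mul_sq_le_sum_mul_div_sq {m n : ℕ} {K : Matrix (Fin m) (Fin n) ℝ} (hrank : K.rank = n)
    {a : Fin m → ℝ} {α : ℝ} (hα : 0 ≤ α) (ha : ∀ i, α ≤ a i)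
    {v : Fin n → ℝ} (hv : ∀ j, 0 < v j) (hKv : ∀ i, 0 < (K *ᵥ v) i)
    {k : Fin n} (hk : ∀ j, v j ≤ v k) (f : Fin n → ℝ) :
    α * sigmaMin K ^ 2 * f k ^ 2 ≤
      normInfRow K ^ 2 * ∑ i, a i * ((K *ᵥ fun j => v j * f j) i / (K *ᵥ v) i) ^ 2 := by
  have hvk := hv k
  refine le_of_mul_le_mul_right ?_ (pow_pos hvk 2)
  have hσ := sigmaMin_sq_mul_le hrank fun j => v j * f j
  have hsingle : (v k * f k) * (v k * f k) ≤ (fun j => v j * f j) ⬝ᵥ fun j => v j * f j :=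
    Finset.single_le_sum (f := fun j => (v j * f j) * (v j * f j))
      (fun j _ => mul_self_nonneg _) (Finset.mem_univ k)
  have hterm (i : Fin m) : α * ((K *ᵥ fun j => v j * f j) i * (K *ᵥ fun j => v j * f j) i) ≤
      (normInfRow K * v k) ^ 2 *
        (a i * ((K *ᵥ fun j => v j * f j) i / (K *ᵥ v) i) ^ 2) := by
    set y := (K *ᵥ fun j => v j * f j) i
    have hi := mulVec_le_normInfRow_mul K (fun j => (abs_of_pos (hv j)).trans_le (hk j)) hvk.le i
    have hi2 := pow_le_pow_left₀ (hKv i).le hi 2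
    have hKvi := (hKv i).ne'
    calc α * (y * y) = (K *ᵥ v) i ^ 2 * (α * (y / (K *ᵥ v) i) ^ 2) := by field_simp
      _ ≤ _ := mul_le_mul hi2 (mul_le_mul_of_nonneg_right (ha i) (sq_nonneg _))
          (mul_nonneg hα (sq_nonneg _)) (sq_nonneg _)
  calc α * sigmaMin K ^ 2 * f k ^ 2 * v k ^ 2
      = α * (sigmaMin K ^ 2 * ((v k * f k) * (v k * f k))) := by ring
    _ ≤ α * ((K *ᵥ fun j => v j * f j) ⬝ᵥ (K *ᵥ fun j => v j * f j)) :=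
        mul_le_mul_of_nonneg_left
          ((mul_le_mul_of_nonneg_left hsingle (sq_nonneg _)).trans hσ) hα
    _ ≤ ∑ i, (normInfRow K * v k) ^ 2 *
        (a i * ((K *ᵥ fun j => v j * f j) i / (K *ᵥ v) i) ^ 2) := by
        rw [dotProduct, Finset.mul_sum]
        exact Finset.sum_le_sum fun i _ => hterm i
    _ = _ := by rw [← Finset.mul_sum]; ring

theorem thetaSq_lower_bound_delta_one
    {m n : ℕ} (hn : 2 ≤ n) (hnm : n ≤ m)
    (K : Matrix (Fin m) (Fin n) ℝ) (hK : ∀ i j, 0 < K i j) (hrank : K.rank = n)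
    (a : Fin m → ℝ) (b : Fin n → ℝ) (ha : ∀ i, 0 < a i) (hb : ∀ j, 0 < b j)
    (hsuma : ∑ i, a i = 1) (hsumb : ∑ j, b j = 1)
    (ustar : Fin m → ℝ) (vstar : Fin n → ℝ)
    (hustar : ∀ i, 0 < ustar i) (hvstar : ∀ j, 0 < vstar j)
    (hsol1 : ∀ i, ustar i * K.mulVec vstar i = a i)
    (hsol2 : ∀ j, vstar j * Kᵀ.mulVec ustar j = b j) :
    (⨅ i, a i) / (⨆ j, b j) * (1 - ⨆ j, b j) /
        ((normInfRow K / sigmaMin K) ^ 2 - ⨅ i, a i) ≤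
      thetaSq K a b ustar vstar := by
  have : Nonempty (Fin n) := ⟨⟨0, by omega⟩⟩
  have : Nonempty (Fin m) := ⟨⟨0, by omega⟩⟩
  obtain ⟨i₀, hi₀⟩ := exists_eq_ciInf_of_finite (f := a)
  obtain ⟨j₀, hj₀⟩ := exists_eq_ciSup_of_finite (f := b)
  have hα (i : Fin m) : (⨅ i, a i) ≤ a i := ciInf_le (Set.finite_range _).bddBelow i
  have hβ (j : Fin n) : b j ≤ ⨆ j, b j := le_ciSup (Set.finite_range _).bddAbove j
  have hαpos : 0 < ⨅ i, a i := hi₀ ▸ ha i₀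
  have hβpos : 0 < ⨆ j, b j := hj₀ ▸ hb j₀
  have hblt (j : Fin n) : b j < 1 := by
    have : Nontrivial (Fin n) := Fin.nontrivial_iff_two_le.2 hn
    obtain ⟨k, hkj⟩ := exists_ne j
    rw [← hsumb]
    exact Finset.single_lt_sum hkj (Finset.mem_univ _) (Finset.mem_univ _) (hb k)
      fun i _ _ => (hb i).le
  have hβlt : (⨆ j, b j) < 1 := hj₀ ▸ hblt j₀
  have hθ := thetaSq_nonneg K a hb ustar vstar
  set α := ⨅ i, a i
  set β := ⨆ j, b j
  rcases le_or_gt ((normInfRow K / sigmaMin K) ^ 2 - α) 0 with hκ | hκ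
  · exact (div_nonpos_of_nonneg_of_nonpos
      (mul_nonneg (div_pos hαpos hβpos).le (sub_pos.2 hβlt).le) hκ).trans hθ
  have hσ : 0 < sigmaMin K := by
    refine lt_of_le_of_ne (sigmaMin_nonneg K) fun h => ?_
    rw [← h] at hκ
    simp only [div_zero] at hκ
    linarith
  obtain ⟨k, hk⟩ := Finite.exists_max vstar
  have hKv (i : Fin m) : 0 < (K *ᵥ vstar) i :=
    Finset.sum_pos (fun j _ => mul_pos (hK i j) (hvstar j)) Finset.univ_nonempty
  let f : Fin n → ℝ := fun j => (if j = k then 1 else 0) - b k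
  let g : Fin m → ℝ := fun i => (K *ᵥ fun j => vstar j * f j) i / (K *ᵥ vstar) i
  have hg (i : Fin m) : a i * g i = ustar i * (K *ᵥ fun j => vstar j * f j) i := by
    have := (hKv i).ne'
    rw [← hsol1 i]
    simp only [g]
    field_simp
  have hf : ∑ j, b j * f j = 0 := by
    simp only [f, mul_sub, Finset.sum_sub_distrib, ← Finset.sum_mul, hsumb]
    simp
  have hf2 : ∑ j, b j * f j ^ 2 = b k * (1 - b k) := by
    have (j : Fin n) : b j * f j ^ 2 =
        (if j = k then b k * (1 - b k) else 0) - b k * (b j * f j) := by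
      simp only [f]
      split_ifs with h
      · subst h; ring
      · ring
    simp only [this, Finset.sum_sub_distrib, ← Finset.mul_sum, hf]
    simp
  have hag : ∑ i, a i * g i = 0 := by
    simp only [hg, sum_mul_mulVec_mul hsol2, hf]
  have hvar := sum_mul_sq_le_thetaSq_mul ha hb hsol2 hf hg
  rw [hf2] at hvar
  set κ := (normInfRow K / sigmaMin K) ^ 2 with hκdef
  set S := ∑ i, a i * g i ^ 2
  have hshift (t : ℝ) : α * (f k + t) ^ 2 ≤ κ * (S + t ^ 2) := by
    have h := mul_sq_le_sum_mul_div_sq hrank hαpos.le hα hvstar hKv hk fun j => f j + t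
    have hsum : ∑ i, a i * ((K *ᵥ fun j => vstar j * (f j + t)) i / (K *ᵥ vstar) i) ^ 2 =
        S + t ^ 2 := by
      have hlin (i : Fin m) :
          (K *ᵥ fun j => vstar j * (f j + t)) i / (K *ᵥ vstar) i = g i + t := by
        have hsplit : (K *ᵥ fun j => vstar j * (f j + t)) i =
            (K *ᵥ fun j => vstar j * f j) i + t * (K *ᵥ vstar) i := by
          simp only [Matrix.mulVec, dotProduct, Finset.mul_sum, ← Finset.sum_add_distrib]
          exact Finset.sum_congr rfl fun j _ => by ring
        rw [hsplit, add_div, mul_div_cancel_right₀ _ (hKv i).ne']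
      calc _ = ∑ i, (a i * g i ^ 2 + 2 * t * (a i * g i) + t ^ 2 * a i) :=
            Finset.sum_congr rfl fun i _ => by rw [hlin]; ring
        _ = S + t ^ 2 := by
            simp only [Finset.sum_add_distrib, ← Finset.mul_sum, hag, hsuma]
            ring
    rw [hsum] at h
    rw [hκdef, div_pow, div_mul_eq_mul_div, le_div_iff₀ (pow_pos hσ 2)]
    linarith
  have hS : α * (1 - b k) ^ 2 ≤ (κ - α) * S := by
    have h := hshift (α * (1 - b k) / (κ - α))
    have hfk : f k = 1 - b k := by simp [f]
    rw [hfk] at h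
    have hκ' := hκ.ne'
    have hκpos : 0 < κ := by linarith
    have e : α * (1 - b k + α * (1 - b k) / (κ - α)) ^ 2 - κ * (α * (1 - b k) / (κ - α)) ^ 2 =
        κ * (α * (1 - b k) ^ 2 / (κ - α)) := by
      field_simp
      ring
    have h' : α * (1 - b k) ^ 2 / (κ - α) ≤ S := le_of_mul_le_mul_left (by linarith) hκpos
    rw [div_le_iff₀ hκ] at h'
    linarith
  have hbk1 := sub_pos.2 (hblt k)
  have hmain : α * (1 - b k) ≤ (κ - α) * (thetaSq K a b ustar vstar * b k) := by
    refine le_of_mul_le_mul_right ?_ hbk1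
    nlinarith [mul_le_mul_of_nonneg_left hvar hκ.le]
  rw [div_le_iff₀ hκ, div_mul_eq_mul_div, div_le_iff₀ hβpos]
  have h1 : α * (1 - β) ≤ α * (1 - b k) :=
    mul_le_mul_of_nonneg_left (by linarith [hβ k]) hαpos.le
  have h2 : thetaSq K a b ustar vstar * (κ - α) * b k ≤
      thetaSq K a b ustar vstar * (κ - α) * β :=
    mul_le_mul_of_nonneg_left (hβ k) (mul_nonneg hθ hκ.le)
  linarith
end

section
/- For every 0 ≤ ϑ < 1 and every 0 < ω < 2 one has ρ_ϑ(ω) < 1. -/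
/-- The asymptotic convergence rate ρ_ϑ(ω) of the overrelaxed Sinkhorn method. -/
noncomputable def sinkhornRate (θ ω : ℝ) : ℝ :=
  if ω ≤ 2 / (1 + Real.sqrt (1 - θ ^ 2)) then
    1 / 4 * (ω * θ + Real.sqrt (ω ^ 2 * θ ^ 2 - 4 * (ω - 1))) ^ 2
  else ω - 1

theorem rate_lt_one (θ : ℝ) (hθ0 : 0 ≤ θ) (hθ1 : θ < 1)
    (ω : ℝ) (hω0 : 0 < ω) (hω2 : ω < 2) :
    sinkhornRate θ ω < 1 := by
  have hωθ : ω * θ < ω := mul_lt_of_lt_one_right hω0 hθ1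
  unfold sinkhornRate
  split_ifs
  · have hsqrt : Real.sqrt (ω ^ 2 * θ ^ 2 - 4 * (ω - 1)) < 2 - ω * θ := by
      rw [Real.sqrt_lt' (by linarith)]
      nlinarith
    nlinarith [Real.sqrt_nonneg (ω ^ 2 * θ ^ 2 - 4 * (ω - 1)), mul_nonneg hω0.le hθ0]
  · linarith
end

section
/- For every 0 < ϑ < 1, the parameter ω^opt = 2/(1 + √(1 − ϑ²)) satisfies ω^opt > 1 and minimizes ρ_ϑ on (0, 2): for all 0 < ω < 2 one has ρ_ϑ(ω) ≥ ρ_ϑ(ω^opt) = ω^opt − 1, with equality if and only if ω = ω^opt. -/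
/-- The discriminant, expanded around the optimal parameter `w = 2 / (1 + s)`. -/
theorem discriminant_eq {θ s w : ℝ} (hs : s ^ 2 = 1 - θ ^ 2) (hw : w * (1 + s) = 2) (ω : ℝ) :
    ω ^ 2 * θ ^ 2 - 4 * (ω - 1) = ((w - ω) * θ) ^ 2 + 4 * s * (w - ω) := by
  have hθ : θ ^ 2 = (1 - s) * (1 + s) := by linear_combination hs
  have hwθ : w * θ ^ 2 = 2 * (1 - s) := by rw [hθ]; linear_combination (1 - s) * hw
  linear_combination (2 * ω - w) * hwθ - 2 * hw

/-- The squared half-sum is strictly larger than its optimal value to the left of the optimum. -/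
theorem sq_lt_sq_add_sqrt_discriminant {θ s w ω : ℝ} (hθ : 0 < θ) (hs0 : 0 < s)
    (hs : s ^ 2 = 1 - θ ^ 2) (hw : w * (1 + s) = 2) (hw0 : 0 < w) (hω : ω < w) :
    (w * θ) ^ 2 < (ω * θ + Real.sqrt (ω ^ 2 * θ ^ 2 - 4 * (ω - 1))) ^ 2 := by
  have hlt : (w - ω) * θ < Real.sqrt (ω ^ 2 * θ ^ 2 - 4 * (ω - 1)) := by
    apply Real.lt_sqrt_of_sq_lt
    rw [discriminant_eq hs hw ω]
    have : 0 < 4 * s * (w - ω) := mul_pos (by positivity) (sub_pos.2 hω)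
    linarith
  have hpos : 0 < w * θ := mul_pos hw0 hθ
  exact pow_lt_pow_left₀ (by linarith) hpos.le two_ne_zero

theorem omega_opt_minimizes_rate (θ : ℝ) (hθ0 : 0 < θ) (hθ1 : θ < 1) :
    1 < 2 / (1 + Real.sqrt (1 - θ ^ 2)) ∧
    sinkhornRate θ (2 / (1 + Real.sqrt (1 - θ ^ 2))) =
      2 / (1 + Real.sqrt (1 - θ ^ 2)) - 1 ∧
    ∀ ω : ℝ, 0 < ω → ω < 2 →
      sinkhornRate θ ω ≥ 2 / (1 + Real.sqrt (1 - θ ^ 2)) - 1 ∧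
      (sinkhornRate θ ω = 2 / (1 + Real.sqrt (1 - θ ^ 2)) - 1 ↔
        ω = 2 / (1 + Real.sqrt (1 - θ ^ 2))) := by
  have hs0 : 0 < Real.sqrt (1 - θ ^ 2) := Real.sqrt_pos.2 (by nlinarith)
  have hs : Real.sqrt (1 - θ ^ 2) ^ 2 = 1 - θ ^ 2 := Real.sq_sqrt (by nlinarith)
  unfold sinkhornRate
  set s := Real.sqrt (1 - θ ^ 2)
  have hw : 2 / (1 + s) * (1 + s) = 2 := div_mul_cancel₀ _ (by positivity)
  have hw0 : 0 < 2 / (1 + s) := by positivity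
  set w := 2 / (1 + s)
  have hs1 : s < 1 := by nlinarith
  have hwsq : (w * θ) ^ 2 = 4 * (w - 1) := by
    have h := discriminant_eq hs hw w
    linear_combination h
  have hrate : 1 / 4 * (w * θ + Real.sqrt (w ^ 2 * θ ^ 2 - 4 * (w - 1))) ^ 2 = w - 1 := by
    rw [discriminant_eq hs hw w]
    simp only [sub_self, zero_mul, mul_zero, ne_eq, OfNat.ofNat_ne_zero, not_false_eq_true,
      zero_pow, add_zero, Real.sqrt_zero]
    linarith
  refine ⟨by nlinarith, by rw [if_pos le_rfl, hrate], fun ω _ _ => ?_⟩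
  rcases lt_trichotomy ω w with h | rfl | h
  · have hlt := sq_lt_sq_add_sqrt_discriminant hθ0 hs0 hs hw hw0 h
    rw [if_pos h.le]
    exact ⟨by linarith, fun he => by linarith, fun he => absurd he h.ne⟩
  · rw [if_pos le_rfl, hrate]
    exact ⟨le_rfl, fun _ => rfl, fun _ => rfl⟩
  · rw [if_neg h.not_ge]
    exact ⟨by linarith, fun he => by linarith, fun he => absurd he h.ne'⟩
end

section
/- For every 0 < ϑ < 1 and every 0 < ω < 2, one has ρ_ϑ(ω) < ϑ² if and only if 1 < ω < 1 + ϑ². In other words, the set of relaxation parameters for which the overrelaxed method is asymptotically strictly faster than the standard Sinkhorn method is exactly the interval (1, 1 + ϑ²). -/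
/-- The optimal relaxation parameter lies strictly inside the interval of acceleration. -/
theorem two_div_one_add_sqrt_lt {θ : ℝ} (hθ0 : 0 < θ) (hθ1 : θ < 1) :
    2 / (1 + Real.sqrt (1 - θ ^ 2)) < 1 + θ ^ 2 := by
  have ht : 0 < Real.sqrt (1 - θ ^ 2) := Real.sqrt_pos.2 (by nlinarith)
  have hsq : Real.sqrt (1 - θ ^ 2) ^ 2 = 1 - θ ^ 2 := Real.sq_sqrt (by nlinarith)
  generalize Real.sqrt (1 - θ ^ 2) = t at *
  have ht1 : t < 1 := by nlinarith
  rw [div_lt_iff₀ (by linarith), show θ ^ 2 = 1 - t ^ 2 by linarith]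
  nlinarith [mul_pos (mul_pos ht (sub_pos.2 ht1)) (by linarith : 0 < 2 + t)]

/-- The overrelaxed rate formula beats `θ ^ 2` exactly for relaxation parameters above `1`. -/
theorem overrelaxed_rate_lt_iff {θ ω : ℝ} (hθ0 : 0 < θ) (hθ1 : θ < 1)
    (hω0 : 0 < ω) (hω2 : ω < 2) :
    1 / 4 * (ω * θ + Real.sqrt (ω ^ 2 * θ ^ 2 - 4 * (ω - 1))) ^ 2 < θ ^ 2 ↔ 1 < ω := by
  have hs := Real.sqrt_nonneg (ω ^ 2 * θ ^ 2 - 4 * (ω - 1))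
  have hpos : 0 < (2 - ω) * θ := mul_pos (by linarith) hθ0
  have hωθ : 0 < ω * θ := mul_pos hω0 hθ0
  calc
    _ ↔ (ω * θ + Real.sqrt (ω ^ 2 * θ ^ 2 - 4 * (ω - 1))) ^ 2 < (2 * θ) ^ 2 := by
      constructor <;> intro h <;> nlinarith
    _ ↔ ω * θ + Real.sqrt (ω ^ 2 * θ ^ 2 - 4 * (ω - 1)) < 2 * θ :=
      pow_lt_pow_iff_left₀ (by linarith) (by linarith) two_ne_zero
    _ ↔ Real.sqrt (ω ^ 2 * θ ^ 2 - 4 * (ω - 1)) < (2 - ω) * θ := by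
      constructor <;> intro h <;> linarith
    _ ↔ 0 < (1 - θ ^ 2) * (ω - 1) := by
      rw [Real.sqrt_lt' hpos]
      constructor <;> intro h <;> nlinarith
    _ ↔ 1 < ω := by
      rw [mul_pos_iff_of_pos_left (by nlinarith), sub_pos]

theorem rate_faster_iff (θ : ℝ) (hθ0 : 0 < θ) (hθ1 : θ < 1)
    (ω : ℝ) (hω0 : 0 < ω) (hω2 : ω < 2) :
    sinkhornRate θ ω < θ ^ 2 ↔ 1 < ω ∧ ω < 1 + θ ^ 2 := by
  unfold sinkhornRate
  split_ifs with h
  · rw [overrelaxed_rate_lt_iff hθ0 hθ1 hω0 hω2]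
    exact ⟨fun h1 => ⟨h1, h.trans_lt (two_div_one_add_sqrt_lt hθ0 hθ1)⟩, And.left⟩
  · have ht : Real.sqrt (1 - θ ^ 2) ≤ 1 := Real.sqrt_le_one.2 (by nlinarith)
    have hopt : 1 ≤ 2 / (1 + Real.sqrt (1 - θ ^ 2)) := by
      rw [one_le_div (by positivity)]
      linarith
    exact ⟨fun h1 => ⟨by linarith, by linarith⟩, fun h1 => by linarith [h1.2]⟩
end

section
/- Let K be an entrywise positive m×n real matrix, a ∈ ℝ^m, b ∈ ℝ^n entrywise positive vectors, and let (u*, v*) be a solution of the scaling problem. Let Λ ≥ 0 satisfy d_H(Kv, Kv′) ≤ Λ d_H(v, v′) for all entrywise positive v, v′ ∈ ℝ^n and d_H(Kᵀu, Kᵀu′) ≤ Λ d_H(u, u′) for all entrywise positive u, u′ ∈ ℝ^m. Let ω > 0 and let (u⁺, v⁺) be obtained from entrywise positive (u, v) by one step of the overrelaxed Sinkhorn update, i.e. u⁺ = u^{1−ω} ∘ (a/(Kv))^ω and v⁺ = v^{1−ω} ∘ (b/(Kᵀu⁺))^ω. Then d_H(u⁺, u*) ≤ |1 − ω| d_H(u,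 u*) + ωΛ d_H(v, v*) and d_H(v⁺, v*) ≤ ωΛ d_H(u⁺, u*) + |1 − ω| d_H(v, v*). -/
open Matrix

theorem dH_le_iff {m : ℕ} {x y : Fin m → ℝ} (hx : ∀ i, 0 < x i) (hy : ∀ i, 0 < y i)
    {c : ℝ} (hc : 0 ≤ c) :
    dH x y ≤ c ↔ ∀ i j,
      (Real.log (x i) - Real.log (y i)) - (Real.log (x j) - Real.log (y j)) ≤ c := by
  rcases isEmpty_or_nonempty (Fin m) with hm | hm
  · simp [dH, hc]
  have hpos : ∀ i j, 0 < x i * y j / (x j * y i) := fun i j =>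
    div_pos (mul_pos (hx i) (hy j)) (mul_pos (hx j) (hy i))
  have hlog : ∀ i j, Real.log (x i * y j / (x j * y i)) =
      (Real.log (x i) - Real.log (y i)) - (Real.log (x j) - Real.log (y j)) := by
    intro i j
    rw [Real.log_div (mul_pos (hx i) (hy j)).ne' (mul_pos (hx j) (hy i)).ne',
      Real.log_mul (hx i).ne' (hy j).ne', Real.log_mul (hx j).ne' (hy i).ne']
    ring
  have hle : ∀ i j, x i * y j / (x j * y i) ≤ ⨆ i, ⨆ j, x i * y j / (x j * y i) :=
    fun i j => (le_ciSup (f := fun j => x i * y j / (x j * y i))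
      (Set.finite_range _).bddAbove j).trans
      (le_ciSup (f := fun i => ⨆ j, x i * y j / (x j * y i)) (Set.finite_range _).bddAbove i)
  constructor
  · intro h i j
    rw [← hlog]
    exact (Real.log_le_log (hpos i j) (hle i j)).trans h
  · intro h
    obtain ⟨k⟩ := hm
    have : Nonempty (Fin m) := ⟨k⟩
    rw [dH, Real.log_le_iff_le_exp ((hpos k k).trans_le (hle k k))]
    refine ciSup_le fun i => ciSup_le fun j => ?_
    rw [← Real.log_le_iff_le_exp (hpos i j), hlog]
    exact h i j

theorem dH_nonneg {m : ℕ} {x y : Fin m → ℝ} (hx : ∀ i, 0 < x i) (hy : ∀ i, 0 < y i) :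
    0 ≤ dH x y := by
  rcases isEmpty_or_nonempty (Fin m) with hm | ⟨⟨k⟩⟩
  · simp [dH]
  refine Real.log_nonneg ?_
  refine le_trans ?_ (le_ciSup (f := fun i => ⨆ j, x i * y j / (x j * y i))
    (Set.finite_range _).bddAbove k)
  refine le_trans ?_ (le_ciSup (f := fun j => x k * y j / (x j * y k))
    (Set.finite_range _).bddAbove k)
  rw [div_self (mul_pos (hx k) (hy k)).ne']

theorem log_ratio_sub_le_dH {m : ℕ} {x y : Fin m → ℝ} (hx : ∀ i, 0 < x i)
    (hy : ∀ i, 0 < y i) (i j : Fin m) :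
    (Real.log (x i) - Real.log (y i)) - (Real.log (x j) - Real.log (y j)) ≤ dH x y :=
  (dH_le_iff hx hy (dH_nonneg hx hy)).1 le_rfl i j

/-- The overrelaxed scaling update, with `q` in the role of the current matrix-vector product and
`qstar` its value at the solution. -/
theorem dH_overrelaxed_le {m : ℕ} {x xstar q qstar a xplus : Fin m → ℝ} {ω : ℝ} (hω : 0 ≤ ω)
    (hx : ∀ i, 0 < x i) (hxstar : ∀ i, 0 < xstar i) (hq : ∀ i, 0 < q i)
    (hqstar : ∀ i, 0 < qstar i) (hsol : ∀ i, xstar i * qstar i = a i)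
    (hxplus : ∀ i, xplus i = x i ^ (1 - ω) * (a i / q i) ^ ω) :
    dH xplus xstar ≤ |1 - ω| * dH x xstar + ω * dH q qstar := by
  have ha : ∀ i, 0 < a i := fun i => hsol i ▸ mul_pos (hxstar i) (hqstar i)
  have hpos : ∀ i, 0 < xplus i := fun i => hxplus i ▸
    mul_pos (Real.rpow_pos_of_pos (hx i) _) (Real.rpow_pos_of_pos (div_pos (ha i) (hq i)) _)
  have hlog : ∀ i, Real.log (xplus i) = (1 - ω) * Real.log (x i) +
      ω * (Real.log (xstar i) + Real.log (qstar i) - Real.log (q i)) := by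
    intro i
    rw [hxplus, Real.log_mul (Real.rpow_pos_of_pos (hx i) _).ne'
      (Real.rpow_pos_of_pos (div_pos (ha i) (hq i)) _).ne', Real.log_rpow (hx i),
      Real.log_rpow (div_pos (ha i) (hq i)), Real.log_div (ha i).ne' (hq i).ne', ← hsol,
      Real.log_mul (hxstar i).ne' (hqstar i).ne']
  have hx0 := dH_nonneg hx hxstar
  have hq0 := dH_nonneg hq hqstar
  refine (dH_le_iff hpos hxstar (by positivity)).2 fun i j => ?_
  have habs : |(Real.log (x i) - Real.log (xstar i)) - (Real.log (x j) - Real.log (xstar j))| ≤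
      dH x xstar :=
    abs_le.2 ⟨by linarith [log_ratio_sub_le_dH hx hxstar j i], log_ratio_sub_le_dH hx hxstar i j⟩
  have h1 := (le_abs_self _).trans ((abs_mul (1 - ω) _).le.trans
    (mul_le_mul_of_nonneg_left habs (abs_nonneg (1 - ω))))
  have h2 := mul_le_mul_of_nonneg_left (log_ratio_sub_le_dH hq hqstar j i) hω
  rw [hlog, hlog]
  linarith

theorem Matrix.mulVec_pos_of_mulVec_ne_zero {m n : ℕ} {K : Matrix (Fin m) (Fin n) ℝ}
    (hK : ∀ i j, 0 < K i j) {w v : Fin n → ℝ} (hv : ∀ j, 0 < v j) {i : Fin m}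
    (hw : K.mulVec w i ≠ 0) : 0 < K.mulVec v i := by
  rcases isEmpty_or_nonempty (Fin n) with hn | hn
  · exact absurd (by simp [Matrix.mulVec, dotProduct]) hw
  · exact Finset.sum_pos (fun j _ => mul_pos (hK i j) (hv j)) Finset.univ_nonempty

theorem one_step_contraction_estimate
    {m n : ℕ} (K : Matrix (Fin m) (Fin n) ℝ) (hK : ∀ i j, 0 < K i j)
    (a : Fin m → ℝ) (b : Fin n → ℝ) (ha : ∀ i, 0 < a i) (hb : ∀ j, 0 < b j)
    (ustar : Fin m → ℝ) (vstar : Fin n → ℝ)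
    (hustar : ∀ i, 0 < ustar i) (hvstar : ∀ j, 0 < vstar j)
    (hsol1 : ∀ i, ustar i * K.mulVec vstar i = a i)
    (hsol2 : ∀ j, vstar j * Kᵀ.mulVec ustar j = b j)
    (Λ : ℝ) (hΛ0 : 0 ≤ Λ)
    (hΛK : ∀ v v' : Fin n → ℝ, (∀ j, 0 < v j) → (∀ j, 0 < v' j) →
      dH (K.mulVec v) (K.mulVec v') ≤ Λ * dH v v')
    (hΛKT : ∀ u u' : Fin m → ℝ, (∀ i, 0 < u i) → (∀ i, 0 < u' i) →
      dH (Kᵀ.mulVec u) (Kᵀ.mulVec u') ≤ Λ * dH u u')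
    (ω : ℝ) (hω : 0 < ω)
    (u : Fin m → ℝ) (v : Fin n → ℝ) (hu : ∀ i, 0 < u i) (hv : ∀ j, 0 < v j)
    (uplus : Fin m → ℝ) (vplus : Fin n → ℝ)
    (huplus : ∀ i, uplus i = u i ^ (1 - ω) * (a i / K.mulVec v i) ^ ω)
    (hvplus : ∀ j, vplus j = v j ^ (1 - ω) * (b j / Kᵀ.mulVec uplus j) ^ ω) :
    dH uplus ustar ≤ |1 - ω| * dH u ustar + ω * Λ * dH v vstar ∧
      dH vplus vstar ≤ ω * Λ * dH uplus ustar + |1 - ω| * dH v vstar := by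
  have hq : ∀ w : Fin n → ℝ, (∀ j, 0 < w j) → ∀ i, 0 < K.mulVec w i := fun w hw i =>
    Matrix.mulVec_pos_of_mulVec_ne_zero hK hw (w := vstar)
      (right_ne_zero_of_mul (hsol1 i ▸ (ha i).ne'))
  have hqT : ∀ w : Fin m → ℝ, (∀ i, 0 < w i) → ∀ j, 0 < Kᵀ.mulVec w j := fun w hw j =>
    Matrix.mulVec_pos_of_mulVec_ne_zero (fun j i => hK i j) hw (w := ustar)
      (right_ne_zero_of_mul (hsol2 j ▸ (hb j).ne'))
  have hup : ∀ i, 0 < uplus i := fun i => huplus i ▸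
    mul_pos (Real.rpow_pos_of_pos (hu i) _)
      (Real.rpow_pos_of_pos (div_pos (ha i) (hq v hv i)) _)
  have h1 := dH_overrelaxed_le hω.le hu hustar (hq v hv) (hq vstar hvstar) hsol1 huplus
  have h2 := dH_overrelaxed_le hω.le hv hvstar (hqT uplus hup) (hqT ustar hustar) hsol2 hvplus
  have h3 := mul_le_mul_of_nonneg_left (hΛK v vstar hv hvstar) hω.le
  have h4 := mul_le_mul_of_nonneg_left (hΛKT uplus ustar hup hustar) hω.le
  constructor <;> linarith
end

section
/- Let K be an entrywise positive m×n real matrix, a ∈ ℝ^m, b ∈ ℝ^n entrywise positive vectors, and (u*, v*) a solution of the scaling problem. Let P* = diag(u*) K diag(v*) and M = diag(1/a) P* diag(1/b) P*ᵀ. Then M maps the all-ones vector 𝟙_m to itself, and every complex eigenvalue of M is real and lies in the interval [0, 1]. -/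
open Matrix

/-- The entries of the product `diag(1/a) P diag(1/b) Pᵀ` applied to a vector. -/
lemma diagonal_mul_mul_diagonal_mul_transpose_mulVec_apply {ι κ 𝕜 : Type*} [Fintype ι]
    [Fintype κ] [DecidableEq ι] [DecidableEq κ] [Field 𝕜] (P : Matrix ι κ 𝕜)
    (a : ι → 𝕜) (b : κ → 𝕜) (x : ι → 𝕜) (i : ι) :
    (diagonal (fun i => 1 / a i) * P * diagonal (fun j => 1 / b j) * Pᵀ).mulVec x i =
      (∑ j, P i j * ((∑ k, P k j * x k) / b j)) / a i := by
  rw [Matrix.mul_assoc, Matrix.mul_assoc, ← mulVec_mulVec, ← mulVec_mulVec, ← mulVec_mulVec,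
    mulVec_diagonal, one_div, inv_mul_eq_div]
  congr 1
  refine Finset.sum_congr rfl fun j _ => ?_
  rw [mulVec_diagonal, one_div, inv_mul_eq_div]
  rfl

/-- Cauchy-Schwarz for a sum with nonnegative weights. -/
lemma norm_sum_mul_sq_le_of_nonneg {ι : Type*} [Fintype ι] (w : ι → ℝ) (hw : ∀ i, 0 ≤ w i)
    (x : ι → ℂ) : ‖∑ i, (w i : ℂ) * x i‖ ^ 2 ≤ (∑ i, w i) * ∑ i, w i * ‖x i‖ ^ 2 := by
  have h : ‖∑ i, (w i : ℂ) * x i‖ ≤ ∑ i, w i * ‖x i‖ := by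
    refine (norm_sum_le _ _).trans_eq (Finset.sum_congr rfl fun i _ => ?_)
    rw [norm_mul, Complex.norm_real, Real.norm_of_nonneg (hw i)]
  refine (pow_le_pow_left₀ (norm_nonneg _) h 2).trans ?_
  exact Finset.sum_sq_le_sum_mul_sum_of_sq_le_mul _ (fun i _ => hw i)
    (fun i _ => mul_nonneg (hw i) (sq_nonneg _)) (fun i _ => le_of_eq (by ring))

/-- For a nonnegative matrix `P` with positive row sums `a` and column sums `b`, an eigenvalue of
`diag(1/a) P diag(1/b) Pᵀ` is real and lies in `[0, 1]`. -/
lemma eigenvalue_mem_unitInterval_of_marginals {ι κ : Type*} [Fintype ι] [Fintype κ]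
    (P : Matrix ι κ ℝ) (hP : ∀ i j, 0 ≤ P i j) (a : ι → ℝ) (b : κ → ℝ)
    (ha : ∀ i, 0 < a i) (hb : ∀ j, 0 < b j)
    (hrow : ∀ i, ∑ j, P i j = a i) (hcol : ∀ j, ∑ i, P i j = b j)
    (μ : ℂ) (x : ι → ℂ) (hx : x ≠ 0)
    (h : ∀ i, (∑ j, (P i j : ℂ) * ((∑ k, (P k j : ℂ) * x k) / b j)) / a i = μ * x i) :
    μ.im = 0 ∧ 0 ≤ μ.re ∧ μ.re ≤ 1 := by
  set y : κ → ℂ := fun j => ∑ k, (P k j : ℂ) * x k with hy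
  set S : ℝ := ∑ i, a i * ‖x i‖ ^ 2 with hS
  set T : ℝ := ∑ j, ‖y j‖ ^ 2 / b j with hT
  have hSpos : 0 < S := by
    obtain ⟨i, hi⟩ := Function.ne_iff.mp hx
    exact Finset.sum_pos' (fun i _ => mul_nonneg (ha i).le (sq_nonneg _))
      ⟨i, Finset.mem_univ i, mul_pos (ha i) (pow_pos (norm_pos_iff.mpr hi) 2)⟩
  have hT0 : 0 ≤ T := Finset.sum_nonneg fun j _ => div_nonneg (sq_nonneg _) (hb j).le
  have hTS : T ≤ S := by
    calc T ≤ ∑ j, ∑ i, P i j * ‖x i‖ ^ 2 := by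
          refine Finset.sum_le_sum fun j _ => ?_
          rw [div_le_iff₀' (hb j), ← hcol j]
          exact norm_sum_mul_sq_le_of_nonneg _ (fun i => hP i j) x
      _ = S := by
          rw [Finset.sum_comm]
          simp_rw [← Finset.sum_mul, hrow, hS]
  have key : μ * (S : ℂ) = (T : ℂ) := by
    calc μ * (S : ℂ) = ∑ i, star (x i) * (a i * (μ * x i)) := by
          rw [hS]
          push_cast
          rw [Finset.mul_sum]
          refine Finset.sum_congr rfl fun i _ => ?_
          rw [← Complex.conj_mul', starRingEnd_apply]
          ring
      _ = ∑ i, ∑ j, star (x i) * ((P i j : ℂ) * (y j / b j)) := by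
          refine Finset.sum_congr rfl fun i _ => ?_
          rw [← h i, mul_div_cancel₀ _ (Complex.ofReal_ne_zero.mpr (ha i).ne'), Finset.mul_sum]
      _ = ∑ j, star (y j) * y j / b j := by
          rw [Finset.sum_comm]
          refine Finset.sum_congr rfl fun j _ => ?_
          have hstar : star (y j) = ∑ i, (P i j : ℂ) * star (x i) := by
            simp [hy]
          rw [mul_div_assoc, hstar, Finset.sum_mul]
          exact Finset.sum_congr rfl fun i _ => by ring
      _ = (T : ℂ) := by
          rw [hT]
          push_cast
          refine Finset.sum_congr rfl fun j _ => ?_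
          rw [← Complex.conj_mul', starRingEnd_apply]
  have hμ : μ = ((T / S : ℝ) : ℂ) := by
    rw [Complex.ofReal_div, ← key, mul_div_cancel_right₀ _ (Complex.ofReal_ne_zero.mpr hSpos.ne')]
  rw [hμ, Complex.ofReal_im, Complex.ofReal_re]
  exact ⟨rfl, div_nonneg hT0 hSpos.le, (div_le_one hSpos).mpr hTS⟩

theorem eigenvalues_of_sinkhorn_iteration_matrix
    {m n : ℕ} (K : Matrix (Fin m) (Fin n) ℝ) (hK : ∀ i j, 0 < K i j)
    (a : Fin m → ℝ) (b : Fin n → ℝ) (ha : ∀ i, 0 < a i) (hb : ∀ j, 0 < b j)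
    (ustar : Fin m → ℝ) (vstar : Fin n → ℝ)
    (hustar : ∀ i, 0 < ustar i) (hvstar : ∀ j, 0 < vstar j)
    (hsol1 : ∀ i, ustar i * K.mulVec vstar i = a i)
    (hsol2 : ∀ j, vstar j * Kᵀ.mulVec ustar j = b j)
    (Pstar : Matrix (Fin m) (Fin n) ℝ)
    (hP : Pstar = Matrix.diagonal ustar * K * Matrix.diagonal vstar)
    (M : Matrix (Fin m) (Fin m) ℝ)
    (hM : M = Matrix.diagonal (fun i => 1 / a i) * Pstar *
      Matrix.diagonal (fun j => 1 / b j) * Pstarᵀ) :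
    M.mulVec (fun _ => 1) = (fun _ => 1) ∧
      ∀ μ ∈ spectrum ℂ (M.map Complex.ofReal),
        μ.im = 0 ∧ 0 ≤ μ.re ∧ μ.re ≤ 1 := by
  have hentry : ∀ i j, Pstar i j = ustar i * K i j * vstar j := fun i j => by
    rw [hP, mul_diagonal, diagonal_mul]
  have hnonneg : ∀ i j, 0 ≤ Pstar i j := fun i j => by
    rw [hentry]
    exact (mul_pos (mul_pos (hustar i) (hK i j)) (hvstar j)).le
  have hrow : ∀ i, ∑ j, Pstar i j = a i := fun i => by
    rw [← hsol1 i, mulVec, dotProduct, Finset.mul_sum]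
    exact Finset.sum_congr rfl fun j _ => by rw [hentry, mul_assoc]
  have hcol : ∀ j, ∑ i, Pstar i j = b j := fun j => by
    rw [← hsol2 j, mulVec, dotProduct, Finset.mul_sum]
    exact Finset.sum_congr rfl fun i _ => by rw [hentry, transpose_apply]; ring
  refine ⟨?_, fun μ hμ => ?_⟩
  · ext i
    rw [hM, diagonal_mul_mul_diagonal_mul_transpose_mulVec_apply]
    simp [hcol, hrow, (ha _).ne', (hb _).ne']
  · rw [← Matrix.spectrum_toLin', ← Module.End.hasEigenvalue_iff_mem_spectrum] at hμ
    obtain ⟨x, hx⟩ := hμ.exists_hasEigenvector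
    refine eigenvalue_mem_unitInterval_of_marginals Pstar hnonneg a b ha hb hrow hcol μ x hx.2
      fun i => ?_
    have hmap : M.map Complex.ofReal = diagonal (fun i => 1 / (a i : ℂ)) *
        Pstar.map Complex.ofReal * diagonal (fun j => 1 / (b j : ℂ)) *
          (Pstar.map Complex.ofReal)ᵀ := by
      ext i j
      simp [hM, Matrix.mul_apply, diagonal_apply]
    have h := congrFun hx.apply_eq_smul i
    rw [toLin'_apply, hmap, diagonal_mul_mul_diagonal_mul_transpose_mulVec_apply] at h
    exact h
end
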